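/- Let P ∈ ℂ[X_1,…,X_n] be a reduced (squarefree) X_1-generic polynomial with factorization P = P_1 ⋯ P_s into distinct irreducible factors, and for j = 1,…,s set B^j_1 = (∏_{k≠j} P_k)·(∂P_j/∂X_1). Let v ∈ ℂ[X_1,…,X_n] and λ_1,…,λ_s ∈ ℂ be pairwise distinct scalars such that v − Σ_{j=1}^s λ_j B^j_1 is divisible by P. Then for each i and each k ≠ i, the irreducible factor P_k does NOT divide v − λ_i·(∂P/∂X_1). -/

import Mathlib

open MvPolynomial

/-- A polynomial `P ∈ ℂ[X_1,…,X_{n+1}]` (variable `0` playing the role of `X_1`)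
is `X_1`-generic if the projection forgetting the first coordinate, restricted to
the hypersurface `V(P)`, has finite fibers: for every `b ∈ ℂⁿ` the set
`{t ∈ ℂ : P(t, b) = 0}` is finite. -/
def IsX1Generic (n : ℕ) (P : MvPolynomial (Fin (n + 1)) ℂ) : Prop :=
  ∀ b : Fin n → ℂ, {t : ℂ | eval (Fin.cons t b) P = 0}.Finite


/-- The Leibniz rule for a derivation applied to a finite product. -/
theorem derivation_finset_prod {R A M ι : Type*} [CommSemiring R] [CommSemiring A]
    [AddCommMonoid M] [Algebra R A] [Module A M] [Module R M] [DecidableEq ι]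
    (D : Derivation R A M) (t : Finset ι) (f : ι → A) :
    D (∏ i ∈ t, f i) = ∑ j ∈ t, (∏ k ∈ t.erase j, f k) • D (f j) := by
  induction t using Finset.induction_on with
  | empty => simp
  | insert a t ha ih =>
    rw [Finset.prod_insert ha, D.leibniz, ih, Finset.sum_insert ha, Finset.erase_insert ha,
      Finset.smul_sum, add_comm]
    congr 1
    refine Finset.sum_congr rfl fun j hj => ?_
    have hja : a ≠ j := fun h => ha (h ▸ hj)
    rw [Finset.erase_insert_of_ne hja, Finset.prod_insert (by simp [ha]), mul_smul]

/-- A non-unit polynomial over an algebraically closed field has a zero. -/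
theorem exists_eval_eq_zero_of_not_isUnit {σ K : Type*} [Finite σ] [Field K] [IsAlgClosed K]
    {Q : MvPolynomial σ K} (hQ : ¬ IsUnit Q) : ∃ x : σ → K, eval x Q = 0 := by
  obtain ⟨M, hM, hQM⟩ := exists_max_ideal_of_mem_nonunits hQ
  obtain ⟨x, rfl⟩ := isMaximal_iff_eq_vanishingIdeal_singleton.1 hM
  exact ⟨x, by simpa using hQM⟩

/-- Restricting to a line parallel to the first axis turns `pderiv 0` into `derivative`. -/
theorem derivative_aeval_cons_X {R : Type*} [CommRing R] {n : ℕ} (b : Fin n → R)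
    (Q : MvPolynomial (Fin (n + 1)) R) :
    Polynomial.derivative
        (aeval (Fin.cons Polynomial.X fun i => Polynomial.C (b i) : Fin (n + 1) → Polynomial R) Q) =
      aeval (Fin.cons Polynomial.X fun i => Polynomial.C (b i) : Fin (n + 1) → Polynomial R)
        (pderiv 0 Q) := by
  induction Q using MvPolynomial.induction_on with
  | C a => simp [Polynomial.algebraMap_eq]
  | add p q hp hq => simp [hp, hq]
  | mul_X p i hp =>
    rw [map_mul, Polynomial.derivative_mul, hp, Derivation.leibniz]
    refine Fin.cases ?_ (fun i => ?_) i
    · simp; ring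
    · simp [pderiv_X]; ring

theorem eval_aeval_cons_X {R : Type*} [CommRing R] {n : ℕ} (b : Fin n → R) (t : R)
    (Q : MvPolynomial (Fin (n + 1)) R) :
    Polynomial.eval t
        (aeval (Fin.cons Polynomial.X fun i => Polynomial.C (b i) : Fin (n + 1) → Polynomial R) Q) =
      eval (Fin.cons t b) Q := by
  induction Q using MvPolynomial.induction_on with
  | C a => simp [Polynomial.algebraMap_eq]
  | add p q hp hq => simp [hp, hq]
  | mul_X p i hp =>
    rw [map_mul, Polynomial.eval_mul, hp, map_mul]
    refine Fin.cases ?_ (fun i => ?_) i <;> simp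

theorem IsX1Generic.of_dvd {n : ℕ} {P Q : MvPolynomial (Fin (n + 1)) ℂ}
    (hP : IsX1Generic n P) (hQP : Q ∣ P) : IsX1Generic n Q := by
  obtain ⟨R, rfl⟩ := hQP
  refine fun b => (hP b).subset fun t (ht : eval _ Q = 0) => ?_
  simp [ht]

/-- A non-unit `X_1`-generic polynomial does not divide its `X_1`-derivative. -/
theorem IsX1Generic.not_dvd_pderiv {n : ℕ} {Q : MvPolynomial (Fin (n + 1)) ℂ}
    (hQ : IsX1Generic n Q) (hunit : ¬ IsUnit Q) : ¬ Q ∣ pderiv 0 Q := by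
  intro hdvd
  obtain ⟨x, hx⟩ := exists_eval_eq_zero_of_not_isUnit hunit
  set b := Fin.tail x
  set f := aeval (R := ℂ)
    (Fin.cons Polynomial.X fun i => Polynomial.C (b i) : Fin (n + 1) → Polynomial ℂ)
  have heval (t : ℂ) : Polynomial.eval t (f Q) = eval (Fin.cons t b) Q := eval_aeval_cons_X b t Q
  have hne : f Q ≠ 0 := fun h0 => Set.infinite_univ ((hQ b).subset fun t _ => by
    simp [← heval, h0])
  have hder : Polynomial.derivative (f Q) = 0 := by
    refine Polynomial.eq_zero_of_dvd_of_degree_lt ?_ (Polynomial.degree_derivative_lt hne)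
    rw [derivative_aeval_cons_X]
    exact map_dvd f hdvd
  have hconst := Polynomial.eq_C_of_derivative_eq_zero hder
  have hroot : Polynomial.eval (x 0) (f Q) = 0 := by
    rw [heval, Fin.cons_self_tail, hx]
  rw [hconst, Polynomial.eval_C] at hroot
  rw [hroot, map_zero] at hconst
  exact hne hconst

/-- let `P = P_1 ⋯ P_s ∈ ℂ[X_1,…,X_{n+1}]` be reduced (squarefree)
and `X_1`-generic, with distinct irreducible factors, and let
`B^j_1 = (∏_{k≠j} P_k)·∂P_j/∂X_1`.  If `λ_1,…,λ_s` are pairwise distinct and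
`v − Σ_j λ_j·B^j_1` is divisible by `P`, then for `k ≠ i` the factor `P_k` does
NOT divide `v − λ_i·∂P/∂X_1`. -/
theorem factor_not_dvd_v_sub_lambda_pderiv
    (n : ℕ) (P : MvPolynomial (Fin (n + 1)) ℂ) (s : ℕ)
    (Q : Fin s → MvPolynomial (Fin (n + 1)) ℂ)
    (hfac : P = ∏ i, Q i) (hirr : ∀ i, Irreducible (Q i))
    (hdist : ∀ i j, i ≠ j → ¬ Associated (Q i) (Q j))
    (hgen : IsX1Generic n P)
    (B : Fin s → MvPolynomial (Fin (n + 1)) ℂ)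
    (hB : ∀ j, B j = (∏ k ∈ Finset.univ.erase j, Q k) * pderiv 0 (Q j))
    (v : MvPolynomial (Fin (n + 1)) ℂ) (lam : Fin s → ℂ)
    (hlam : ∀ i j, i ≠ j → lam i ≠ lam j)
    (hv : P ∣ v - ∑ j, C (lam j) * B j) :
    ∀ i k, k ≠ i → ¬ Q k ∣ v - C (lam i) * pderiv 0 P := by
  intro i k hki hdvd
  have hPk : Q k ∣ P := hfac ▸ Finset.dvd_prod_of_mem Q (Finset.mem_univ k)
  have hprime : Prime (Q k) := (hirr k).prime
  have hderiv : pderiv 0 P = ∑ j, B j := by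
    rw [hfac, derivation_finset_prod]
    exact Finset.sum_congr rfl fun j _ => by rw [hB, smul_eq_mul]
  have hBdvd (j : Fin s) (hj : j ≠ k) : Q k ∣ B j := by
    rw [hB]
    exact (Finset.dvd_prod_of_mem Q (by simp [hj.symm])).mul_right _
  have hsum : Q k ∣ ∑ j, C (lam j - lam i) * B j := by
    have h := dvd_sub hdvd (hPk.trans hv)
    rw [sub_sub_sub_cancel_left, hderiv, Finset.mul_sum, ← Finset.sum_sub_distrib] at h
    simpa only [C_sub, sub_mul] using h
  rw [← Finset.add_sum_erase _ _ (Finset.mem_univ k)] at hsum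
  have hterm : Q k ∣ C (lam k - lam i) * B k :=
    (dvd_add_left (Finset.dvd_sum fun j hj =>
      (hBdvd j (Finset.ne_of_mem_erase hj)).mul_left _)).1 hsum
  have hunit : IsUnit (C (lam k - lam i) : MvPolynomial (Fin (n + 1)) ℂ) :=
    (sub_ne_zero.2 (hlam k i hki)).isUnit.map C
  rw [hunit.dvd_mul_left, hB] at hterm
  rcases hprime.dvd_or_dvd hterm with h | h
  · obtain ⟨j, hj, hkj⟩ := (hprime.dvd_finsetProd_iff Q).1 h
    exact hdist k j (Finset.ne_of_mem_erase hj).symm ((hirr k).associated_of_dvd (hirr j) hkj)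
  · exact (hgen.of_dvd hPk).not_dvd_pderiv (hirr k).not_isUnit h
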